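/- Let n ≥ 3 and let f, g : ℂ → ℂ be entire functions with fⁿ + gⁿ = 1 on ℂ. Then f and g are both constant (Iyer's theorem). -/

import Mathlib

open Metric Filter Topology

/-- A nonvanishing entire function has an entire logarithm. -/
theorem iyer_log (q : ℂ → ℂ) (hq : Differentiable ℂ q) (h0 : ∀ z, q z ≠ 0) :
    ∃ u : ℂ → ℂ, Differentiable ℂ u ∧ ∀ z, q z = Complex.exp (u z) := by
  have hd : Differentiable ℂ (fun z => deriv q z / q z) :=
    hq.deriv.div hq h0
  obtain ⟨v, hv⟩ := hd.isExactOn_univ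
  have hv' : ∀ z, HasDerivAt v (deriv q z / q z) z := fun z => hv z (Set.mem_univ z)
  have hG : ∀ z, HasDerivAt (fun z => q z * Complex.exp (-(v z))) 0 z := by
    intro z
    have h1 := (hq z).hasDerivAt.mul (hv' z).neg.cexp
    refine h1.congr_deriv ?_
    have := h0 z
    field_simp
    simp
  have hc : ∀ z, q z * Complex.exp (-(v z)) = q 0 * Complex.exp (-(v 0)) := fun z =>
    is_const_of_deriv_eq_zero (fun z => (hG z).differentiableAt) (fun z => (hG z).deriv) z 0
  refine ⟨fun z => v z + (Complex.log (q 0) - v 0),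
    fun z => (hv' z).differentiableAt.add_const _, fun z => ?_⟩
  have h2 := hc z
  rw [Complex.exp_add, Complex.exp_sub, Complex.exp_log (h0 0)]
  rw [Complex.exp_neg, Complex.exp_neg] at h2
  have e1 := Complex.exp_ne_zero (v z)
  have e2 := Complex.exp_ne_zero (v 0)
  field_simp at h2 ⊢
  linear_combination h2

/-- Local covering lemma. -/
theorem iyer_cover (h : ℂ → ℂ) (hh : Differentiable ℂ h) (p : ℂ) (t : ℝ) (ht : 0 < t)
    (hp : deriv h p ≠ 0) (hb : ∀ z ∈ ball p t, ‖deriv h z‖ ≤ 2 * ‖deriv h p‖) :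
    ball (h p) (‖deriv h p‖ * t / 24) ⊆ Set.range h := by
  have hM : 0 < ‖deriv h p‖ := norm_pos_iff.2 hp
  set M := ‖deriv h p‖ with hMdef
  have hmaps : Set.MapsTo (deriv h) (ball p t) (closedBall (deriv h p) (3 * M)) := by
    intro z hz
    rw [mem_closedBall, dist_eq_norm]
    have := norm_sub_le (deriv h z) (deriv h p)
    have := hb z hz
    linarith
  have hS : ∀ z ∈ closedBall p (t / 6), ‖deriv h z - deriv h p‖ ≤ M / 2 := by
    intro z hz
    rw [mem_closedBall] at hz
    have hz' : z ∈ ball p t := by rw [mem_ball]; linarith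
    have := Complex.dist_le_div_mul_dist_of_mapsTo_ball hh.deriv.differentiableOn hmaps hz'
    rw [dist_eq_norm] at this
    refine this.trans ?_
    calc 3 * M / t * dist z p ≤ 3 * M / t * (t / 6) := by gcongr
      _ = M / 2 := by field_simp; norm_num
  have hlin : ∀ z ∈ sphere p (t / 6), M * t / 12 ≤ ‖h z - h p‖ := by
    intro z hz
    have hz1 : z ∈ closedBall p (t / 6) := sphere_subset_closedBall hz
    have hk : ‖(h z - deriv h p * z) - (h p - deriv h p * p)‖ ≤ M / 2 * ‖z - p‖ := by
      refine (convex_closedBall p (t / 6)).norm_image_sub_le_of_norm_hasDerivWithin_le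
        (f := fun z => h z - deriv h p * z) (f' := fun z => deriv h z - deriv h p)
        (fun x _ => ?_) hS (mem_closedBall_self (by positivity)) hz1
      have := (hh x).hasDerivAt.sub ((hasDerivAt_id x).const_mul (deriv h p))
      exact (this.congr_deriv (by simp)).hasDerivWithinAt
    have hzn : ‖z - p‖ = t / 6 := by simpa [dist_eq_norm] using hz
    have h3 : ‖deriv h p * (z - p)‖ = M * (t / 6) := by rw [norm_mul, hzn]
    have h4 : deriv h p * (z - p) =
        (h z - h p) - ((h z - deriv h p * z) - (h p - deriv h p * p)) := by ring
    have h5 := norm_sub_le (h z - h p) ((h z - deriv h p * z) - (h p - deriv h p * p))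
    rw [← h4, h3] at h5
    rw [hzn] at hk
    linarith
  have hfr : ∃ᶠ z in 𝓝 p, h z ≠ h p :=
    ((hh p).hasDerivAt.eventually_ne hp).frequently.filter_mono nhdsWithin_le_nhds
  have := (hh.diffContOnCl (s := ball p (t / 6))).ball_subset_image_closedBall
    (by positivity) hlin hfr
  rw [show M * t / 12 / 2 = M * t / 24 by ring] at this
  exact this.trans (Set.image_subset_range _ _)

/-- Weak Bloch theorem: a nonconstant entire function covers arbitrarily large discs. -/
theorem iyer_bloch (h : ℂ → ℂ) (hh : Differentiable ℂ h) (a : ℂ) (ha : deriv h a ≠ 0) (s : ℝ)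
    (hs : 0 < s) : ∃ w, ball w s ⊆ Set.range h := by
  have hA : 0 < ‖deriv h a‖ := norm_pos_iff.2 ha
  set R : ℝ := 48 * s / ‖deriv h a‖ with hR
  have hR0 : 0 < R := by positivity
  have hcont : Continuous (fun z => ‖deriv h z‖ * (R - dist z a)) := by
    have := hh.deriv.continuous
    fun_prop
  obtain ⟨p, hpm, hp⟩ := (isCompact_closedBall a R).exists_isMaxOn
    ⟨a, mem_closedBall_self hR0.le⟩ hcont.continuousOn
  have hpm' : dist p a ≤ R := hpm
  have h1 : ‖deriv h a‖ * R ≤ ‖deriv h p‖ * (R - dist p a) := by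
    have : ‖deriv h a‖ * (R - dist a a) ≤ ‖deriv h p‖ * (R - dist p a) :=
      hp (mem_closedBall_self hR0.le)
    simpa using this
  have hRA : ‖deriv h a‖ * R = 48 * s := by rw [hR]; field_simp
  have hpos : 0 < ‖deriv h p‖ * (R - dist p a) := by
    rw [hRA] at h1; linarith
  have hR2 : 0 < R - dist p a := by
    rcases (sub_nonneg.2 hpm').lt_or_eq with h | h
    · exact h
    · rw [← h] at hpos; simp at hpos
  have hP : 0 < ‖deriv h p‖ := pos_of_mul_pos_left hpos hR2.le
  have := iyer_cover h hh p ((R - dist p a) / 2) (by positivity) (norm_pos_iff.1 hP) ?_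
  · refine ⟨h p, (ball_subset_ball ?_).trans this⟩
    rw [hRA] at h1
    linarith
  · intro z hz
    rw [mem_ball] at hz
    have htri := dist_triangle z p a
    have hz2 : z ∈ closedBall a R := by rw [mem_closedBall]; linarith
    have h2 : ‖deriv h z‖ * (R - dist z a) ≤ ‖deriv h p‖ * (R - dist p a) := hp hz2
    have h3 : ‖deriv h z‖ * ((R - dist p a) / 2) ≤ ‖deriv h z‖ * (R - dist z a) := by
      gcongr; linarith
    have h4 : ‖deriv h z‖ * (R - dist p a) ≤ (2 * ‖deriv h p‖) * (R - dist p a) := by linarith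
    exact le_of_mul_le_mul_right h4 hR2

theorem iyer_cosh_real (x : ℝ) : ∃ s : ℝ, |s - x| ≤ 1 ∧ ∃ m : ℤ, Real.cosh s ^ 2 = m := by
  have key : ∀ x : ℝ, 0 ≤ x → ∃ s : ℝ, |s - x| ≤ 1 ∧ ∃ m : ℤ, Real.cosh s ^ 2 = m := by
    intro x hx
    have hc : ContinuousOn (fun s => Real.cosh s ^ 2) (Set.Icc x (x + 1)) :=
      (Real.continuous_cosh.pow 2).continuousOn
    have hsub := intermediate_value_Icc (by linarith : x ≤ x + 1) hc
    have h1 : (3 / 2 : ℝ) ≤ Real.cosh 1 := by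
      rw [Real.cosh_eq]
      have e1 := Real.exp_one_gt_d9
      have e2 := Real.exp_pos (-1)
      have e3 : (0.3 : ℝ) < Real.exp (-1) := by
        rw [Real.exp_neg, lt_inv_comm₀ (by norm_num) (by positivity)]
        have := Real.exp_one_lt_d9
        norm_num at this ⊢
        linarith
      linarith
    have hcx := Real.one_le_cosh x
    have h2 : 3 / 2 * Real.cosh x ≤ Real.cosh (x + 1) := by
      rw [Real.cosh_add]
      have := mul_nonneg (Real.sinh_nonneg_iff.2 hx) (Real.sinh_nonneg_iff.2 zero_le_one)
      nlinarith
    have hm : ((⌈Real.cosh x ^ 2⌉ : ℤ) : ℝ) ∈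
        Set.Icc (Real.cosh x ^ 2) (Real.cosh (x + 1) ^ 2) := by
      refine ⟨Int.le_ceil _, (Int.ceil_lt_add_one _).le.trans ?_⟩
      nlinarith
    obtain ⟨s, hs, hs2⟩ := hsub hm
    exact ⟨s, abs_le.2 ⟨by linarith [hs.1], by linarith [hs.2]⟩, _, hs2⟩
  rcases le_total 0 x with hx | hx
  · exact key x hx
  · obtain ⟨s, hs, m, hm⟩ := key (-x) (by linarith)
    refine ⟨-s, ?_, m, by rw [Real.cosh_neg, hm]⟩
    rw [← abs_neg]
    convert hs using 2
    ring

theorem iyer_cosh (w : ℂ) : ∃ a ∈ ball w 10, ∃ m : ℤ, Complex.cosh a ^ 2 = m := by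
  obtain ⟨s, hs, m, hm⟩ := iyer_cosh_real w.re
  set k : ℤ := round (w.im / Real.pi) with hk
  have hpi := Real.pi_pos
  have him : |k * Real.pi - w.im| ≤ 2 := by
    have h1 := abs_sub_round (w.im / Real.pi)
    have h2 : k * Real.pi - w.im = -((w.im / Real.pi - k) * Real.pi) := by field_simp; ring
    rw [h2, abs_neg, abs_mul, abs_of_pos hpi]
    have := Real.pi_le_four
    nlinarith [abs_nonneg (w.im / Real.pi - k)]
  refine ⟨(s : ℂ) + (((k * Real.pi : ℝ)) : ℂ) * Complex.I, ?_, m, ?_⟩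
  · rw [mem_ball, dist_eq_norm]
    refine (Complex.norm_le_abs_re_add_abs_im _).trans_lt ?_
    simp only [Complex.sub_re, Complex.sub_im, Complex.add_re, Complex.add_im, Complex.ofReal_re,
      Complex.ofReal_im, Complex.re_ofReal_mul, Complex.im_ofReal_mul, Complex.I_re, Complex.I_im,
      mul_zero, mul_one, add_zero, zero_add]
    linarith
  · rw [Complex.cosh_add, Complex.cosh_mul_I, Complex.sinh_mul_I, ← Complex.ofReal_sin,
      ← Complex.ofReal_cos, Real.sin_int_mul_pi, ← Complex.ofReal_cosh]
    have h1 : Real.cos (k * Real.pi) ^ 2 = 1 := by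
      rw [← sq_abs, Real.abs_cos_int_mul_pi]; norm_num
    have h2 : (Real.cosh s * Real.cos (k * Real.pi)) ^ 2 = (m : ℝ) := by
      rw [mul_pow, h1, hm, mul_one]
    simp only [Complex.ofReal_zero, zero_mul, mul_zero, add_zero]
    exact_mod_cast h2

/-- Little Picard theorem for the omitted values 0 and 1. -/
theorem iyer_picard (q : ℂ → ℂ) (hq : Differentiable ℂ q) (h0 : ∀ z, q z ≠ 0)
    (h1 : ∀ z, q z ≠ 1) : ∀ z, q z = q 0 := by
  obtain ⟨u, hu, hqu⟩ := iyer_log q hq h0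
  have hpi := Complex.two_pi_I_ne_zero
  set F : ℂ → ℂ := fun z => u z / (2 * Real.pi * Complex.I) with hFdef
  have hF : Differentiable ℂ F := hu.div_const _
  have hFu : ∀ z, u z = F z * (2 * Real.pi * Complex.I) := fun z => by
    simp only [hFdef]; field_simp
  have hFm : ∀ z (m : ℤ), F z ≠ m := by
    intro z m hm
    apply h1 z
    rw [hqu, hFu, hm, Complex.exp_int_mul_two_pi_mul_I]
  obtain ⟨a, had, ha⟩ := iyer_log F hF (fun z => by simpa using hFm z 0)
  obtain ⟨b, hbd, hb⟩ := iyer_log (fun z => F z - 1) (hF.sub_const 1)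
    (fun z => sub_ne_zero.2 (by simpa using hFm z 1))
  set A : ℂ → ℂ := fun z => Complex.exp (a z / 2)
  set B : ℂ → ℂ := fun z => Complex.exp (b z / 2)
  have hA : ∀ z, A z ^ 2 = F z := fun z => by
    rw [ha z, ← Complex.exp_nat_mul]; congr 1; push_cast; ring
  have hB : ∀ z, B z ^ 2 = F z - 1 := fun z => by
    rw [hb z, ← Complex.exp_nat_mul]; congr 1; push_cast; ring
  have hAB : ∀ z, (A z - B z) * (A z + B z) = 1 := fun z => by
    linear_combination hA z - hB z
  obtain ⟨h, hh, hhe⟩ := iyer_log (fun z => A z - B z)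
    ((had.div_const 2).cexp.sub (hbd.div_const 2).cexp) (fun z => left_ne_zero_of_mul_eq_one (hAB z))
  have hcosh : ∀ z, Complex.cosh (h z) ^ 2 = F z := by
    intro z
    have : Complex.exp (-(h z)) = A z + B z := by
      rw [Complex.exp_neg, ← hhe z]
      exact inv_eq_of_mul_eq_one_right (hAB z)
    rw [Complex.cosh, this, ← hhe z, ← hA z]
    ring
  have hder : ∀ z, deriv h z = 0 := by
    intro z
    by_contra hne
    obtain ⟨w, hw⟩ := iyer_bloch h hh z hne 10 (by norm_num)
    obtain ⟨c, hc, m, hm⟩ := iyer_cosh w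
    obtain ⟨y, rfl⟩ := hw hc
    exact hFm y m (by rw [← hcosh, hm])
  intro z
  rw [hqu z, hqu 0, hFu z, hFu 0, ← hcosh z, ← hcosh 0, is_const_of_deriv_eq_zero hh hder z 0]

theorem iyer_const_of_pow (n : ℕ) (hn : n ≠ 0) (g : ℂ → ℂ) (hg : Differentiable ℂ g) (c : ℂ)
    (hc : ∀ z, g z ^ n = c) : ∃ b : ℂ, ∀ z, g z = b := by
  apply hg.exists_const_forall_eq_of_bounded
  refine (isBounded_closedBall (x := (0 : ℂ)) (r := ‖g 0‖)).subset ?_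
  rintro _ ⟨z, rfl⟩
  rw [mem_closedBall_zero_iff]
  refine le_of_pow_le_pow_left₀ hn (norm_nonneg _) ?_
  rw [← norm_pow, ← norm_pow, hc, hc]

theorem iyer_theorem (n : ℕ) (hn : 3 ≤ n) (f g : ℂ → ℂ)
    (hf : Differentiable ℂ f) (hg : Differentiable ℂ g)
    (heq : ∀ z : ℂ, f z ^ n + g z ^ n = 1) :
    (∃ a : ℂ, ∀ z, f z = a) ∧ (∃ b : ℂ, ∀ z, g z = b) := by
  have hn0 : n ≠ 0 := by omega
  obtain ⟨ω, hω⟩ := IsAlgClosed.exists_pow_nat_eq (-1 : ℂ) (Nat.pos_of_ne_zero hn0)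
  have hω0 : ω ≠ 0 := by
    rintro rfl
    rw [zero_pow hn0] at hω
    norm_num at hω
  have hζ := Complex.isPrimitiveRoot_exp n hn0
  set ζ := Complex.exp (2 * Real.pi * Complex.I / n)
  have hζn := hζ.pow_eq_one
  have hζ0 : ζ ≠ 0 := hζ.ne_zero hn0
  have hζ1 : ζ ≠ 1 := hζ.ne_one (by omega)
  have hζ2 : ζ ^ 2 ≠ 1 := hζ.pow_ne_one_of_pos_of_lt (by norm_num) (by omega)
  have hfac : ∀ η : ℂ, η ^ n = -1 → ∀ z, f z - η * g z ≠ 0 := by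
    intro η hη z h
    have h1 := heq z
    rw [sub_eq_zero.1 h, mul_pow, hη] at h1
    norm_num at h1
  have hX1 := hfac ω hω
  have hX2 := hfac (ω * ζ) (by rw [mul_pow, hζn, hω, mul_one])
  have hX3 := hfac (ω * ζ ^ 2) (by rw [mul_pow, ← pow_mul, mul_comm 2 n, pow_mul, hζn, hω]; simp)
  -- q = -(ω₂ - ω₃) X₁ / ((ω₃ - ω₁) X₂)
  have d21 : ζ - 1 ≠ 0 := sub_ne_zero.2 hζ1
  have d31 : ζ ^ 2 - 1 ≠ 0 := sub_ne_zero.2 hζ2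
  have hq := iyer_picard
    (fun z => (ζ * (ζ - 1) * (f z - ω * g z)) / ((ζ ^ 2 - 1) * (f z - ω * ζ * g z)))
    (by
      refine Differentiable.div (by fun_prop) (by fun_prop) (fun z => mul_ne_zero d31 (hX2 z)))
    (fun z => div_ne_zero (mul_ne_zero (mul_ne_zero hζ0 d21) (hX1 z)) (mul_ne_zero d31 (hX2 z)))
    (fun z h => by
      rw [div_eq_one_iff_eq (mul_ne_zero d31 (hX2 z))] at h
      have : (1 - ζ) * (f z - ω * ζ ^ 2 * g z) = 0 := by linear_combination h
      rcases mul_eq_zero.1 this with h' | h'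
      · exact hζ1 (sub_eq_zero.1 h').symm
      · exact hX3 z h')
  obtain ⟨c, hc⟩ : ∃ c : ℂ, ∀ z, f z - ω * g z = c * (f z - ω * ζ * g z) := by
    refine ⟨(f 0 - ω * g 0) / (f 0 - ω * ζ * g 0), fun z => ?_⟩
    have h := hq z
    have x1 := hX2 z
    have x2 := hX2 0
    rw [div_eq_div_iff (mul_ne_zero d31 x1) (mul_ne_zero d31 x2)] at h
    have hk : ζ * (ζ - 1) * (ζ ^ 2 - 1) ≠ 0 := mul_ne_zero (mul_ne_zero hζ0 d21) d31
    rw [div_mul_eq_mul_div, eq_div_iff x2]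
    apply mul_left_cancel₀ hk
    linear_combination h
  by_cases hc1 : c = 1
  · have hg0 : ∀ z, g z = 0 := by
      intro z
      have h := hc z
      rw [hc1] at h
      have : (ω * (ζ - 1)) * g z = 0 := by linear_combination h
      exact (mul_eq_zero.1 this).resolve_left (mul_ne_zero hω0 d21)
    refine ⟨iyer_const_of_pow n hn0 f hf 1 (fun z => ?_), 0, hg0⟩
    have := heq z
    rwa [hg0, zero_pow hn0, add_zero] at this
  · have hc1' : 1 - c ≠ 0 := sub_ne_zero.2 (Ne.symm hc1)
    obtain ⟨k, hk⟩ : ∃ k : ℂ, ∀ z, f z = k * g z := by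
      refine ⟨ω * (1 - c * ζ) / (1 - c), fun z => ?_⟩
      rw [div_mul_eq_mul_div, eq_div_iff hc1']
      linear_combination hc z
    have hgk : ∀ z, (k ^ n + 1) * g z ^ n = 1 := by
      intro z
      have := heq z
      rw [hk, mul_pow] at this
      linear_combination this
    obtain ⟨b, hb⟩ := iyer_const_of_pow n hn0 g hg (k ^ n + 1)⁻¹
      (fun z => eq_inv_of_mul_eq_one_right (hgk z))
    exact ⟨⟨k * b, fun z => by rw [hk, hb]⟩, b, hb⟩
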